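/- Let P ⊆ E and Q ⊆ F be polytopes, each with at least two vertices, in finite-dimensional real inner product spaces. Then the pyramidal width of the product is strictly smaller than both individual pyramidal widths: δ(P × Q) < min{δ(P), δ(Q)}, where P × Q is taken in E × F with the ℓ² product norm. -/

import Mathlib

section Defs

variable {E : Type*} [NormedAddCommGroup E] [InnerProductSpace ℝ E]

/-- The (Euclidean) distance between two sets. -/
noncomputable def setDist {X : Type*} [PseudoMetricSpace X] (A B : Set X) : ℝ :=
  sInf ((fun p : X × X => dist p.1 p.2) '' (A ×ˢ B))

/-- A polytope: the convex hull of a nonempty finite set of points. -/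
def IsPolytope (S : Set E) : Prop :=
  ∃ V : Set E, V.Finite ∧ V.Nonempty ∧ S = convexHull ℝ V

/-- A face of `P`: a nonempty proper exposed face. -/
def IsFaceOf (P f : Set E) : Prop :=
  IsExposed ℝ P f ∧ f.Nonempty ∧ f ≠ P

/-- `P^f = conv(V(P) \ V(f))`, where `V(·)` denotes the set of extreme points. -/
noncomputable def compPoly (P f : Set E) : Set E :=
  convexHull ℝ (P.extremePoints ℝ \ f.extremePoints ℝ)

/-- The pyramidal width `δ(P) = min over faces f of dist(f, P^f)`. -/
noncomputable def pyramidalWidth (P : Set E) : ℝ :=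
  sInf {d : ℝ | ∃ f : Set E, IsFaceOf P f ∧ d = setDist f (compPoly P f)}

end Defs

section SetDist

variable {X : Type*} [PseudoMetricSpace X]

theorem setDist_nonneg (A B : Set X) : 0 ≤ setDist A B := by
  refine Real.sInf_nonneg ?_
  rintro _ ⟨p, -, rfl⟩
  exact dist_nonneg

theorem setDist_le_dist {A B : Set X} {a b : X} (ha : a ∈ A) (hb : b ∈ B) :
    setDist A B ≤ dist a b := by
  refine csInf_le ⟨0, ?_⟩ ⟨(a, b), ⟨ha, hb⟩, rfl⟩
  rintro _ ⟨p, -, rfl⟩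
  exact dist_nonneg

theorem IsCompact.exists_setDist_eq_dist {A B : Set X} (hA : IsCompact A) (hB : IsCompact B)
    (hA' : A.Nonempty) (hB' : B.Nonempty) : ∃ a ∈ A, ∃ b ∈ B, setDist A B = dist a b := by
  have hc : IsCompact ((fun p : X × X => dist p.1 p.2) '' (A ×ˢ B)) :=
    (hA.prod hB).image (by fun_prop)
  obtain ⟨⟨a, b⟩, ⟨ha, hb⟩, h⟩ := hc.sInf_mem ((hA'.prod hB').image _)
  exact ⟨a, ha, b, hb, h.symm⟩

end SetDist

section Polytope

variable {E F : Type*} [NormedAddCommGroup E] [InnerProductSpace ℝ E]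
  [NormedAddCommGroup F] [InnerProductSpace ℝ F] {P f : Set E} {Q g : Set F}

theorem IsPolytope.isCompact (hP : IsPolytope P) : IsCompact P := by
  obtain ⟨V, hV, -, rfl⟩ := hP
  exact hV.isCompact_convexHull ℝ

theorem IsPolytope.convex (hP : IsPolytope P) : Convex ℝ P := by
  obtain ⟨V, -, -, rfl⟩ := hP
  exact convex_convexHull ℝ V

theorem IsPolytope.finite_extremePoints (hP : IsPolytope P) : (P.extremePoints ℝ).Finite := by
  obtain ⟨V, hV, -, rfl⟩ := hP
  exact hV.subset extremePoints_convexHull_subset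

/-- The Krein–Milman theorem for sets with finitely many extreme points. -/
theorem IsCompact.convexHull_extremePoints_of_finite (hP : IsCompact P) (hc : Convex ℝ P)
    (hfin : (P.extremePoints ℝ).Finite) : convexHull ℝ (P.extremePoints ℝ) = P := by
  rw [← (hfin.isClosed_convexHull ℝ).closure_eq, closure_convexHull_extremePoints hP hc]

theorem IsPolytope.convexHull_extremePoints (hP : IsPolytope P) :
    convexHull ℝ (P.extremePoints ℝ) = P :=
  hP.isCompact.convexHull_extremePoints_of_finite hP.convex hP.finite_extremePoints

theorem IsFaceOf.extremePoints_subset (hf : IsFaceOf P f) :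
    f.extremePoints ℝ ⊆ P.extremePoints ℝ :=
  hf.1.isExtreme.extremePoints_subset_extremePoints

theorem IsFaceOf.convexHull_extremePoints (hP : IsPolytope P) (hf : IsFaceOf P f) :
    convexHull ℝ (f.extremePoints ℝ) = f :=
  (hf.1.isCompact hP.isCompact).convexHull_extremePoints_of_finite (hf.1.convex hP.convex)
    (hP.finite_extremePoints.subset hf.extremePoints_subset)

theorem IsFaceOf.disjoint_compPoly (hP : IsPolytope P) (hf : IsFaceOf P f) :
    Disjoint f (compPoly P f) := by
  have h : compPoly P f ⊆ P \ f := by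
    refine convexHull_min ?_ (hf.1.isExtreme.convex_sdiff hP.convex)
    rintro x ⟨hx, hxf⟩
    exact ⟨hx.1, fun hx' => hxf (hf.1.isExtreme.extremePoints_eq ▸ ⟨hx', hx⟩)⟩
  exact Set.disjoint_left.2 fun x hx hx' => (h hx').2 hx

theorem IsFaceOf.compPoly_nonempty (hP : IsPolytope P) (hf : IsFaceOf P f) :
    (compPoly P f).Nonempty := by
  rw [compPoly, convexHull_nonempty_iff, Set.nonempty_iff_ne_empty, Ne, Set.sdiff_eq_empty]
  intro h
  apply hf.2.2
  rw [← hf.convexHull_extremePoints hP, h.antisymm hf.extremePoints_subset |>.symm,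
    hP.convexHull_extremePoints]

theorem IsFaceOf.exists_setDist_eq_dist (hP : IsPolytope P) (hf : IsFaceOf P f) :
    ∃ x ∈ f, ∃ y ∈ compPoly P f, setDist f (compPoly P f) = dist x y ∧ 0 < dist x y := by
  obtain ⟨x, hx, y, hy, h⟩ := (hf.1.isCompact hP.isCompact).exists_setDist_eq_dist
    ((hP.finite_extremePoints.subset Set.sdiff_subset).isCompact_convexHull ℝ)
    hf.2.1 (hf.compPoly_nonempty hP)
  refine ⟨x, hx, y, hy, h, dist_pos.2 ?_⟩
  rintro rfl
  exact Set.disjoint_left.1 (hf.disjoint_compPoly hP) hx hy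

theorem IsPolytope.exists_isFaceOf (hP : IsPolytope P) (hPv : P.Nontrivial) :
    ∃ f, IsFaceOf P f := by
  obtain ⟨v, hv, w, hw, hvw⟩ := hPv
  let l : StrongDual ℝ E := innerSL ℝ (v - w)
  refine ⟨l.toExposed P, ContinuousLinearMap.toExposed.isExposed, ?_, ?_⟩
  · obtain ⟨x, hx, hmax⟩ := hP.isCompact.exists_isMaxOn ⟨v, hv⟩ l.continuous.continuousOn
    exact ⟨x, hx, fun y hy => hmax hy⟩
  · intro h
    have hle : l v ≤ l w := (h.ge hw).2 v hv
    have hpos : 0 < inner ℝ (v - w) (v - w) := real_inner_self_pos.2 (sub_ne_zero.2 hvw)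
    rw [inner_sub_right] at hpos
    simp only [l, innerSL_apply_apply] at hle
    linarith

theorem IsPolytope.exists_pyramidalWidth_eq_dist (hP : IsPolytope P) (hPv : P.Nontrivial) :
    ∃ f, IsFaceOf P f ∧ ∃ x ∈ f, ∃ y ∈ compPoly P f,
      pyramidalWidth P = dist x y ∧ 0 < dist x y := by
  have hfin : {d : ℝ | ∃ f : Set E, IsFaceOf P f ∧ d = setDist f (compPoly P f)}.Finite := by
    refine (hP.finite_extremePoints.finite_subsets.image fun s =>
      setDist (convexHull ℝ s) (convexHull ℝ (P.extremePoints ℝ \ s))).subset ?_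
    rintro _ ⟨f, hf, rfl⟩
    refine ⟨f.extremePoints ℝ, hf.extremePoints_subset, ?_⟩
    simp only [hf.convexHull_extremePoints hP, compPoly]
  obtain ⟨f₀, hf₀⟩ := hP.exists_isFaceOf hPv
  have hne : {d : ℝ | ∃ f : Set E, IsFaceOf P f ∧ d = setDist f (compPoly P f)}.Nonempty :=
    ⟨_, f₀, hf₀, rfl⟩
  obtain ⟨f, hf, hd⟩ := hne.csInf_mem hfin
  obtain ⟨x, hx, y, hy, h, hpos⟩ := hf.exists_setDist_eq_dist hP
  exact ⟨f, hf, x, hx, y, hy, hd.trans h, hpos⟩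

theorem IsFaceOf.pyramidalWidth_le_dist (hf : IsFaceOf P f) {x y : E} (hx : x ∈ f)
    (hy : y ∈ compPoly P f) : pyramidalWidth P ≤ dist x y := by
  refine le_trans (csInf_le ⟨0, ?_⟩ ⟨f, hf, rfl⟩) (setDist_le_dist hx hy)
  rintro _ ⟨f, -, rfl⟩
  exact setDist_nonneg _ _

theorem IsFaceOf.prod (hf : IsFaceOf P f) (hg : IsFaceOf Q g) :
    IsFaceOf ((WithLp.prodContinuousLinearEquiv 2 ℝ E F).symm '' (P ×ˢ Q))
      ((WithLp.prodContinuousLinearEquiv 2 ℝ E F).symm '' (f ×ˢ g)) := by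
  refine ⟨fun _ => ?_, (hf.2.1.prod hg.2.1).image _, fun h => ?_⟩
  · obtain ⟨⟨l, hl⟩, ⟨m, hm⟩⟩ := And.intro (hf.1 hf.2.1) (hg.1 hg.2.1)
    obtain ⟨⟨p, hp⟩, ⟨q, hq⟩⟩ := And.intro hf.2.1 hg.2.1
    refine ⟨(l.coprod m).comp (WithLp.prodContinuousLinearEquiv 2 ℝ E F).toContinuousLinearMap, ?_⟩
    rw [hl] at hp
    rw [hm] at hq
    rw [hl, hm]
    ext z
    obtain ⟨⟨x, y⟩, rfl⟩ := (WithLp.prodContinuousLinearEquiv 2 ℝ E F).symm.surjective z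
    simp only [(WithLp.prodContinuousLinearEquiv 2 ℝ E F).symm.injective.mem_set_image,
      Set.mem_prod, Set.mem_ofPred_eq, Set.forall_mem_image, ContinuousLinearMap.comp_apply,
      ContinuousLinearEquiv.coe_coe, ContinuousLinearEquiv.apply_symm_apply,
      ContinuousLinearMap.coprod_apply, Prod.forall]
    constructor
    · rintro ⟨⟨hx, hx'⟩, hy, hy'⟩
      exact ⟨⟨hx, hy⟩, fun a b hab => add_le_add (hx' a hab.1) (hy' b hab.2)⟩
    · rintro ⟨⟨hx, hy⟩, h⟩
      refine ⟨⟨hx, fun a ha => ?_⟩, hy, fun b hb => ?_⟩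
      · simpa using h a y ⟨ha, hy⟩
      · simpa using h x b ⟨hx, hb⟩
  · have h' := (WithLp.prodContinuousLinearEquiv 2 ℝ E F).symm.injective.image_injective h
    rw [Set.prod_eq_prod_iff_of_nonempty (hf.2.1.prod hg.2.1)] at h'
    exact hf.2.2 h'.1

theorem compPoly_prod (P f : Set E) (Q g : Set F) :
    compPoly ((WithLp.prodContinuousLinearEquiv 2 ℝ E F).symm '' (P ×ˢ Q))
      ((WithLp.prodContinuousLinearEquiv 2 ℝ E F).symm '' (f ×ˢ g)) =
    (WithLp.prodContinuousLinearEquiv 2 ℝ E F).symm '' convexHull ℝ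
      ((P.extremePoints ℝ ×ˢ Q.extremePoints ℝ) \ (f.extremePoints ℝ ×ˢ g.extremePoints ℝ)) := by
  rw [compPoly, ← image_extremePoints, ← image_extremePoints, extremePoints_prod,
    extremePoints_prod,
    ← Set.image_sdiff (WithLp.prodContinuousLinearEquiv 2 ℝ E F).symm.injective]
  exact ((WithLp.prodContinuousLinearEquiv 2 ℝ E F).symm.toLinearMap.image_convexHull _).symm

end Polytope

/-- The pyramidal width of a product of polytopes (each with at least two vertices) is
strictly smaller than both individual pyramidal widths:
`δ(P × Q) < min{δ(P), δ(Q)}`, the product being taken in `E × F` with the ℓ² product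
norm. -/
theorem pyramidalWidth_prod_lt_min
    {E F : Type*} [NormedAddCommGroup E] [InnerProductSpace ℝ E] [FiniteDimensional ℝ E]
    [NormedAddCommGroup F] [InnerProductSpace ℝ F] [FiniteDimensional ℝ F]
    (P : Set E) (Q : Set F) (hP : IsPolytope P) (hQ : IsPolytope Q)
    (hPv : (P.extremePoints ℝ).Nontrivial) (hQv : (Q.extremePoints ℝ).Nontrivial) :
    pyramidalWidth ((WithLp.equiv 2 (E × F)).symm '' (P ×ˢ Q)) <
      min (pyramidalWidth P) (pyramidalWidth Q) := by
  obtain ⟨f, hf, x, hx, y, hy, hd, hdpos⟩ :=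
    hP.exists_pyramidalWidth_eq_dist (hPv.mono extremePoints_subset)
  obtain ⟨g, hg, u, hu, z, hz, he, hepos⟩ :=
    hQ.exists_pyramidalWidth_eq_dist (hQv.mono extremePoints_subset)
  have hyu : (y, u) ∈ convexHull ℝ ((P.extremePoints ℝ ×ˢ Q.extremePoints ℝ) \
      (f.extremePoints ℝ ×ˢ g.extremePoints ℝ)) := by
    refine convexHull_mono (s := (P.extremePoints ℝ \ f.extremePoints ℝ) ×ˢ g.extremePoints ℝ)
      (fun p hp => ?_) ?_
    · exact ⟨⟨hp.1.1, hg.extremePoints_subset hp.2⟩, fun h => hp.1.2 h.1⟩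
    · rw [convexHull_prod, hg.convexHull_extremePoints hQ]
      exact ⟨hy, hu⟩
  have hxz : (x, z) ∈ convexHull ℝ ((P.extremePoints ℝ ×ˢ Q.extremePoints ℝ) \
      (f.extremePoints ℝ ×ˢ g.extremePoints ℝ)) := by
    refine convexHull_mono (s := f.extremePoints ℝ ×ˢ (Q.extremePoints ℝ \ g.extremePoints ℝ))
      (fun p hp => ?_) ?_
    · exact ⟨⟨hf.extremePoints_subset hp.1, hp.2.1⟩, fun h => hp.2.2 h.2⟩
    · rw [convexHull_prod, hf.convexHull_extremePoints hP]
      exact ⟨hx, hz⟩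
  rw [hd, he]
  set d := dist x y with hd_def
  set e := dist u z with he_def
  have hs : 0 < d ^ 2 + e ^ 2 := by positivity
  set t := d ^ 2 / (d ^ 2 + e ^ 2) with ht
  have ht0 : 0 ≤ t := by positivity
  have ht1 : t ≤ 1 := (div_le_one hs).2 (by nlinarith)
  have hmem := convex_convexHull ℝ _ hyu hxz (sub_nonneg.2 ht1) ht0 (sub_add_cancel 1 t)
  have hle := (hf.prod hg).pyramidalWidth_le_dist (Set.mem_image_of_mem _ (Set.mk_mem_prod hx hu))
    (compPoly_prod P f Q g ▸ Set.mem_image_of_mem _ hmem)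
  refine lt_of_le_of_lt hle ?_
  have h1 : x - ((1 - t) • y + t • x) = (1 - t) • (x - y) := by module
  have h2 : u - ((1 - t) • u + t • z) = t • (u - z) := by module
  have h3 : ((1 - t) * d) ^ 2 + (t * e) ^ 2 = d ^ 2 * e ^ 2 / (d ^ 2 + e ^ 2) := by
    rw [ht]
    field_simp
    ring
  have h4 : dist ((WithLp.prodContinuousLinearEquiv 2 ℝ E F).symm (x, u))
      ((WithLp.prodContinuousLinearEquiv 2 ℝ E F).symm ((1 - t) • (y, u) + t • (x, z))) =
      √(d ^ 2 * e ^ 2 / (d ^ 2 + e ^ 2)) := by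
    rw [WithLp.prod_dist_eq_of_L2, ← h3]
    congr 3
    · change dist x ((1 - t) • y + t • x) = _
      rw [dist_eq_norm, h1, norm_smul, Real.norm_of_nonneg (sub_nonneg.2 ht1), hd_def,
        dist_eq_norm]
    · change dist u ((1 - t) • u + t • z) = _
      rw [dist_eq_norm, h2, norm_smul, Real.norm_of_nonneg ht0, he_def, dist_eq_norm]
  rw [h4, lt_min_iff, Real.sqrt_lt' hdpos, Real.sqrt_lt' hepos, div_lt_iff₀ hs, div_lt_iff₀ hs]
  have hd4 : 0 < d ^ 2 * d ^ 2 := by positivity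
  have he4 : 0 < e ^ 2 * e ^ 2 := by positivity
  constructor <;> nlinarith
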